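/- Every component of order m−1 is an extended 1-perfect code of length n = 2^m. -/

import Mathlib

open Finset Pointwise

abbrev Word (n : ℕ) := Fin n → ZMod 2

def FEv (n : ℕ) : Set (Word n) := {x | Even (hammingNorm x)}

def FOd (n : ℕ) : Set (Word n) := {x | ¬ Even (hammingNorm x)}

def nbr {n : ℕ} (S : Set (Word n)) : Set (Word n) := {y | ∃ x ∈ S, hammingDist y x = 1}

def theta {n : ℕ} (G : Set (Word n)) : Set (Word n) :=
  {x | Even (hammingNorm x) ∧ nbr {x} ⊆ nbr G}

def ExtPerfect {n : ℕ} (C : Set (Word n)) : Prop :=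
  C ⊆ FEv n ∧ (∀ x ∈ C, ∀ y ∈ C, x ≠ y → Disjoint (nbr {x}) (nbr {y})) ∧ nbr C = FOd n

def IsIsometry {n : ℕ} (g : Word n → Word n) : Prop :=
  Function.Bijective g ∧ ∀ x y, hammingDist (g x) (g y) = hammingDist x y

def embWord (m t : ℕ) (v : Word (2 ^ (m - t))) : Word (2 ^ m) := fun i =>
  if h : (i : ℕ) < 2 ^ (m - t) then v ⟨i, h⟩
  else if h2 : (i : ℕ) < 2 * 2 ^ (m - t) then v ⟨(i : ℕ) - 2 ^ (m - t), by omega⟩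
  else 0

def Vt (m t : ℕ) : Set (Word (2 ^ m)) :=
  {x | ∃ v : Word (2 ^ (m - t)), Even (hammingNorm v) ∧ x = embWord m t v}

def At (m : ℕ) : ℕ → Set (Word (2 ^ m))
  | 0 => {0}
  | 1 => Vt m 1
  | t + 2 => Vt m (t + 2) + At m (t + 1)

def IsComp (m t : ℕ) (G : Set (Word (2 ^ m))) : Prop :=
  G ⊆ FEv (2 ^ m) ∧ G.ncard = (At m t).ncard ∧ nbr G = nbr (At m t)

def IsMuComp (m t : ℕ) (μ : Word (2 ^ m)) (M : Set (Word (2 ^ m))) : Prop :=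
  (∀ i : Fin (2 ^ m), 2 ^ (m - t) ≤ (i : ℕ) → μ i = 0) ∧
  ∃ G, IsComp m t G ∧ M = (fun x => μ + x) '' G

def arrEntry (m t : ℕ) (x : Word (2 ^ m)) (i : Fin (2 ^ t)) (j : Fin (2 ^ (m - t))) : ZMod 2 :=
  x ⟨((i : ℕ) * 2 ^ (m - t) + (j : ℕ)) % 2 ^ m, Nat.mod_lt _ (Nat.two_pow_pos m)⟩

def pchk (m t : ℕ) (x : Word (2 ^ m)) : Word (2 ^ (m - t)) :=
  fun j => ∑ i : Fin (2 ^ t), arrEntry m t x i j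

def Bt (m : ℕ) : ℕ → Set (Word (2 ^ m))
  | 0 => Vt m 1
  | 1 => Vt m 1
  | t + 2 => Vt m (t + 2) + theta (At m (t + 1))

theorem even_hammingNorm_iff {N : ℕ} (v : Word N) : Even (hammingNorm v) ↔ ∑ i, v i = 0 := by
  have h : ∑ i, v i = (hammingNorm v : ZMod 2) := by
    rw [hammingNorm, Finset.card_filter, Nat.cast_sum]
    refine Finset.sum_congr rfl fun i _ => ?_
    generalize v i = a
    revert a
    decide
  rw [h, ZMod.natCast_eq_zero_iff_even]

theorem hammingDist_eq_one_iff {N : ℕ} (y x : Word N) :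
    hammingDist y x = 1 ↔ ∃ i, y = x + Pi.single i 1 := by
  constructor
  · intro h
    obtain ⟨i, hi⟩ := Finset.card_eq_one.mp h
    refine ⟨i, funext fun j => ?_⟩
    have hj : y j ≠ x j ↔ j = i := by simpa using Finset.ext_iff.mp hi j
    have key : ∀ a b : ZMod 2, a ≠ b → a = b + 1 := by decide
    by_cases hji : j = i
    · subst hji
      simpa using key _ _ (hj.mpr rfl)
    · simpa [hji] using hj
  · rintro ⟨i, rfl⟩
    refine Finset.card_eq_one.mpr ⟨i, ?_⟩
    ext j
    by_cases hji : j = i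
    · subst hji
      simp
    · simp [hji]

theorem zmod_two_eq_one {a : ZMod 2} (h : a ≠ 0) : a = 1 := by
  revert a
  decide

theorem sum_add_single {N : ℕ} (v : Word N) (i : Fin N) :
    ∑ j, (v + Pi.single i 1 : Word N) j = ∑ j, v j + 1 := by
  simp [Finset.sum_add_distrib]

/-- Exactly half of the words of positive length have any given parity. -/
theorem two_mul_ncard_sum_eq {N : ℕ} (hN : 0 < N) (c : ZMod 2) :
    2 * {v : Word N | ∑ i, v i = c}.ncard = 2 ^ N := by
  let e : Word N := Pi.single ⟨0, hN⟩ 1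
  have hcompl : {v : Word N | ∑ i, v i = c}ᶜ = (fun v => v + e) '' {v : Word N | ∑ i, v i = c} := by
    ext w
    constructor
    · intro hw
      refine ⟨w + e, ?_, ?_⟩
      · have hc : ∀ a c : ZMod 2, a ≠ c → a + 1 = c := by decide
        exact (sum_add_single _ _).trans (hc _ _ hw)
      · funext j
        simp [add_assoc, CharTwo.add_self_eq_zero]
    · rintro ⟨v, hv, rfl⟩ hw
      have hs := sum_add_single v ⟨0, hN⟩
      have hc : ∀ a b : ZMod 2, b = a + 1 → b ≠ a := by decide
      exact hc _ _ hs (hw.trans hv.symm)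
  have h := Set.ncard_add_ncard_compl {v : Word N | ∑ i, v i = c}
  rw [hcompl, Set.ncard_image_of_injective _ (add_left_injective e), Nat.card_eq_fintype_card,
    Fintype.card_fun, ZMod.card, Fintype.card_fin] at h
  omega

theorem embWord_add (m t : ℕ) (v w : Word (2 ^ (m - t))) :
    embWord m t (v + w) = embWord m t v + embWord m t w := by
  funext i
  simp only [embWord, Pi.add_apply]
  split_ifs <;> simp

theorem Vt_add_mem {m t : ℕ} {x y : Word (2 ^ m)} (hx : x ∈ Vt m t) (hy : y ∈ Vt m t) :
    x + y ∈ Vt m t := by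
  obtain ⟨v, hv, rfl⟩ := hx
  obtain ⟨w, hw, rfl⟩ := hy
  refine ⟨v + w, ?_, (embWord_add m t v w).symm⟩
  rw [even_hammingNorm_iff] at *
  simp [Finset.sum_add_distrib, hv, hw]

theorem zero_mem_Vt (m t : ℕ) : (0 : Word (2 ^ m)) ∈ Vt m t :=
  ⟨0, by simp, by funext i; simp [embWord]⟩

theorem two_mul_ncard_Vt_le (m t : ℕ) : 2 * (Vt m t).ncard ≤ 2 ^ 2 ^ (m - t) := by
  rw [← two_mul_ncard_sum_eq (Nat.two_pow_pos (m - t)) 0]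
  have h : Vt m t = embWord m t '' {v : Word (2 ^ (m - t)) | ∑ i, v i = 0} := by
    ext x
    simp only [Vt, even_hammingNorm_iff, Set.mem_ofPred_eq, Set.mem_image, eq_comm]
  rw [h]
  exact Nat.mul_le_mul_left 2 (Set.ncard_image_le (Set.toFinite _))

theorem At_succ (m t : ℕ) : At m (t + 1) = Vt m (t + 1) + At m t := by
  cases t with
  | zero => simp [At]
  | succ t => rfl

theorem zero_mem_At (m t : ℕ) : (0 : Word (2 ^ m)) ∈ At m t := by
  induction t with
  | zero => simp [At]
  | succ t ih =>
    rw [At_succ]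
    exact ⟨0, zero_mem_Vt m (t + 1), 0, ih, add_zero 0⟩

theorem At_add_mem {m t : ℕ} {x y : Word (2 ^ m)} (hx : x ∈ At m t) (hy : y ∈ At m t) :
    x + y ∈ At m t := by
  induction t generalizing x y with
  | zero =>
    simp only [At, Set.mem_singleton_iff] at *
    simp [hx, hy]
  | succ t ih =>
    rw [At_succ] at *
    obtain ⟨a, ha, b, hb, rfl⟩ := hx
    obtain ⟨c, hc, d, hd, rfl⟩ := hy
    exact ⟨a + c, Vt_add_mem ha hc, b + d, ih hb hd, add_add_add_comm a c b d⟩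

theorem Vt_subset_At {m s t : ℕ} (hs : 1 ≤ s) (hst : s ≤ t) : Vt m s ⊆ At m t := by
  induction t, hst using Nat.le_induction with
  | base =>
    obtain ⟨r, rfl⟩ := Nat.exists_eq_add_of_le' hs
    rw [At_succ]
    exact fun x hx => ⟨x, hx, 0, zero_mem_At m r, add_zero x⟩
  | succ t _ ih =>
    rw [At_succ]
    exact fun x hx => ⟨0, zero_mem_Vt m (t + 1), x, ih hx, zero_add x⟩

theorem ncard_At_mul_le {m t : ℕ} (ht : t ≤ m) :
    (At m t).ncard * 2 ^ (2 ^ (m - t) + t) ≤ 2 ^ 2 ^ m := by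
  induction t with
  | zero => simp [At]
  | succ t ih =>
    have hpow : 2 ^ (m - t) = 2 ^ (m - (t + 1)) + 2 ^ (m - (t + 1)) := by
      rw [show m - t = m - (t + 1) + 1 by omega]
      ring
    have hadd : (Vt m (t + 1) + At m t).ncard ≤ (Vt m (t + 1)).ncard * (At m t).ncard := by
      simpa only [Nat.card_coe_set_eq] using Set.natCard_add_le (s := Vt m (t + 1)) (t := At m t)
    calc (At m (t + 1)).ncard * 2 ^ (2 ^ (m - (t + 1)) + (t + 1))
        ≤ (Vt m (t + 1)).ncard * (At m t).ncard * 2 ^ (2 ^ (m - (t + 1)) + (t + 1)) := by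
          rw [At_succ]
          exact Nat.mul_le_mul_right _ hadd
      _ = (2 * (Vt m (t + 1)).ncard) * ((At m t).ncard * 2 ^ (2 ^ (m - (t + 1)) + t)) := by ring
      _ ≤ 2 ^ 2 ^ (m - (t + 1)) * ((At m t).ncard * 2 ^ (2 ^ (m - (t + 1)) + t)) :=
          Nat.mul_le_mul_right _ (two_mul_ncard_Vt_le m (t + 1))
      _ = (At m t).ncard * 2 ^ (2 ^ (m - t) + t) := by
          rw [hpow]
          ring
      _ ≤ 2 ^ 2 ^ m := ih (by omega)

/-- Extend or truncate a word to length `M`, padding with zeros. -/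
def padWord {N : ℕ} (M : ℕ) (v : Word N) : Word M := fun i =>
  if h : (i : ℕ) < N then v ⟨i, h⟩ else 0

/-- Concatenation of two words of length `2 ^ k`. -/
def joinWord {k : ℕ} (p q : Word (2 ^ k)) : Word (2 ^ (k + 1)) := fun i =>
  if h : (i : ℕ) < 2 ^ k then p ⟨i, h⟩ else q ⟨(i : ℕ) - 2 ^ k, by have := i.2; omega⟩

theorem exists_eq_joinWord {k : ℕ} (u : Word (2 ^ (k + 1))) :
    ∃ p q : Word (2 ^ k), u = joinWord p q := by
  refine ⟨fun j => u ⟨j, by have := j.2; omega⟩, fun j => u ⟨j + 2 ^ k, by have := j.2; omega⟩, ?_⟩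
  funext i
  simp only [joinWord]
  split_ifs with h
  · rfl
  · congr 1
    ext
    simp only
    omega

theorem sum_joinWord {k : ℕ} (p q : Word (2 ^ k)) :
    ∑ i, joinWord p q i = ∑ i, p i + ∑ i, q i := by
  have hk : 2 ^ k + 2 ^ k = 2 ^ (k + 1) := by ring
  rw [← (finCongr hk).sum_comp, Fin.sum_univ_add]
  simp [joinWord]

theorem joinWord_add {k : ℕ} (p q r s : Word (2 ^ k)) :
    joinWord (p + r) (q + s) = joinWord p q + joinWord r s := by
  funext i
  simp only [joinWord, Pi.add_apply]
  split_ifs <;> rfl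

theorem joinWord_single_zero {k : ℕ} (i : Fin (2 ^ k)) :
    ∃ j, joinWord (Pi.single i 1) 0 = Pi.single j 1 := by
  refine ⟨⟨i, by have := i.2; omega⟩, funext fun j => ?_⟩
  simp only [joinWord, Pi.single_apply, Fin.ext_iff, Pi.zero_apply]
  have := i.2
  split_ifs <;> first | rfl | omega

theorem joinWord_zero_single {k : ℕ} (i : Fin (2 ^ k)) :
    ∃ j, joinWord 0 (Pi.single i 1) = Pi.single j 1 := by
  refine ⟨⟨i + 2 ^ k, by have := i.2; omega⟩, funext fun j => ?_⟩
  simp only [joinWord, Pi.single_apply, Fin.ext_iff, Pi.zero_apply]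
  split_ifs <;> first | rfl | omega

theorem padWord_add {N M : ℕ} (v w : Word N) :
    padWord M (v + w) = padWord M v + padWord M w := by
  funext i
  simp only [padWord, Pi.add_apply]
  split_ifs <;> simp

theorem padWord_joinWord_zero {k M : ℕ} (c : Word (2 ^ k)) :
    padWord M (joinWord c 0) = padWord M c := by
  funext i
  simp only [padWord, joinWord, Pi.zero_apply]
  split_ifs <;> first | rfl | omega

theorem padWord_joinWord_self_mem_Vt {m t : ℕ} {v : Word (2 ^ (m - t))} (hv : ∑ i, v i = 0) :
    padWord (2 ^ m) (joinWord v v) ∈ Vt m t := by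
  refine ⟨v, (even_hammingNorm_iff v).mpr hv, ?_⟩
  funext i
  simp only [padWord, joinWord, embWord]
  split_ifs <;> first | rfl | omega

theorem padWord_joinWord_self_mem_At {m k : ℕ} (hk : 1 ≤ k) (hkm : k < m) {v : Word (2 ^ k)}
    (hv : ∑ i, v i = 0) : padWord (2 ^ m) (joinWord v v) ∈ At m (m - 1) := by
  obtain ⟨t, ht, ht1, ht2⟩ : ∃ t, k = m - t ∧ 1 ≤ t ∧ t ≤ m - 1 := ⟨m - k, by omega⟩
  subst ht
  exact Vt_subset_At ht1 ht2 (padWord_joinWord_self_mem_Vt hv)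

theorem exists_padWord_mem_At_add_single {m k : ℕ} (hk : 1 ≤ k) (hkm : k ≤ m) (u : Word (2 ^ k))
    (hu : ∑ i, u i = 1) :
    ∃ a : Word (2 ^ k), padWord (2 ^ m) a ∈ At m (m - 1) ∧ ∃ i, u = a + Pi.single i 1 := by
  induction k, hk using Nat.le_induction with
  | base =>
    refine ⟨0, ?_, ?_⟩
    · convert zero_mem_At m (m - 1)
      funext i
      simp [padWord]
    · revert u
      decide
  | succ k hk ih =>
    obtain ⟨p, q, rfl⟩ := exists_eq_joinWord u
    rw [sum_joinWord] at hu
    obtain ⟨c, hc, i, hi⟩ := ih (by omega) (p + q) (by simpa [Finset.sum_add_distrib] using hu)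
    have hcsum : ∑ j, c j = 0 := by
      have h := sum_add_single c i
      rw [← hi] at h
      simpa [Finset.sum_add_distrib, hu] using h
    by_cases hq : ∑ j, q j = 0
    · obtain ⟨j, hj⟩ := joinWord_single_zero i
      refine ⟨joinWord q q + joinWord c 0, ?_, j, ?_⟩
      · rw [padWord_add, padWord_joinWord_zero]
        exact At_add_mem (padWord_joinWord_self_mem_At hk (by omega) hq) hc
      · rw [← hj, ← joinWord_add, ← joinWord_add, add_assoc, ← hi, add_left_comm,
          CharTwo.add_self_eq_zero]
        simp
    · have hp : ∑ j, p j = 0 := by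
        rw [zmod_two_eq_one hq] at hu
        simpa using hu
      obtain ⟨j, hj⟩ := joinWord_zero_single i
      refine ⟨joinWord (p + c) (p + c) + joinWord c 0, ?_, j, ?_⟩
      · rw [padWord_add, padWord_joinWord_zero]
        refine At_add_mem (padWord_joinWord_self_mem_At hk (by omega) ?_) hc
        simp [Finset.sum_add_distrib, hp, hcsum]
      · rw [← hj, ← joinWord_add, ← joinWord_add, add_zero, add_assoc p c c, add_zero,
          CharTwo.add_self_eq_zero, add_zero, add_assoc p c, ← hi, ← add_assoc,
          CharTwo.add_self_eq_zero, zero_add]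

theorem FOd_subset_nbr_At {m : ℕ} (hm : 1 ≤ m) : FOd (2 ^ m) ⊆ nbr (At m (m - 1)) := by
  intro u hu
  have hu1 : ∑ i, u i = 1 := zmod_two_eq_one fun h => hu ((even_hammingNorm_iff u).mpr h)
  obtain ⟨a, ha, i, hi⟩ := exists_padWord_mem_At_add_single hm le_rfl u hu1
  have hpad : padWord (2 ^ m) a = a := by
    funext j
    simp [padWord]
  exact ⟨a, hpad ▸ ha, (hammingDist_eq_one_iff u a).mpr ⟨i, hi⟩⟩

theorem nbr_subset_FOd {N : ℕ} {G : Set (Word N)} (hG : G ⊆ FEv N) : nbr G ⊆ FOd N := by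
  rintro y ⟨x, hx, hyx⟩ hy
  obtain ⟨i, rfl⟩ := (hammingDist_eq_one_iff y x).mp hyx
  have h := (even_hammingNorm_iff _).mp hy
  rw [sum_add_single, (even_hammingNorm_iff x).mp (hG hx)] at h
  simp at h

/-- A set of even words covering all odd words is an extended perfect code as soon as it is not
larger than the sphere-packing count. -/
theorem extPerfect_of_card_le {N : ℕ} (hN : 0 < N) {G : Set (Word N)} (hG : G ⊆ FEv N)
    (hcov : FOd N ⊆ nbr G) (hcard : 2 * (G.ncard * N) ≤ 2 ^ N) : ExtPerfect G := by
  let f : Word N × Fin N → Word N := fun p => p.1 + Pi.single p.2 1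
  have himage : FOd N ⊆ f '' (G ×ˢ Set.univ) := by
    intro y hy
    obtain ⟨x, hx, hyx⟩ := hcov hy
    obtain ⟨i, rfl⟩ := (hammingDist_eq_one_iff y x).mp hyx
    exact ⟨(x, i), ⟨hx, trivial⟩, rfl⟩
  have hodd : FOd N = {v : Word N | ∑ i, v i = 1} := by
    ext v
    change ¬ Even (hammingNorm v) ↔ ∑ i, v i = 1
    rw [even_hammingNorm_iff]
    exact ⟨zmod_two_eq_one, fun h => by simp [h]⟩
  have hinj : Set.InjOn f (G ×ˢ Set.univ) := by
    apply Set.injOn_of_ncard_image_eq _ (Set.toFinite _)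
    apply le_antisymm (Set.ncard_image_le (Set.toFinite _))
    have h1 := Set.ncard_le_ncard himage (Set.toFinite _)
    have h2 := two_mul_ncard_sum_eq hN 1
    rw [← hodd] at h2
    rw [Set.ncard_prod, Set.ncard_univ, Nat.card_eq_fintype_card, Fintype.card_fin]
    omega
  refine ⟨hG, fun x hx y hy hxy => ?_, (nbr_subset_FOd hG).antisymm hcov⟩
  rw [Set.disjoint_left]
  rintro z ⟨_, rfl, hzx⟩ ⟨_, rfl, hzy⟩
  obtain ⟨i, hi⟩ := (hammingDist_eq_one_iff _ _).mp hzx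
  obtain ⟨j, hj⟩ := (hammingDist_eq_one_iff _ _).mp hzy
  exact hxy (congrArg Prod.fst
    (hinj (x₁ := (_, i)) (x₂ := (_, j)) ⟨hx, trivial⟩ ⟨hy, trivial⟩ (hi.symm.trans hj)))

/-- every component of order m-1 is an extended 1-perfect code of length n = 2^m. -/
theorem stmt_3 (m : ℕ) (hm : 4 ≤ m) (G : Set (Word (2 ^ m)))
    (hG : IsComp m (m - 1) G) : ExtPerfect G := by
  obtain ⟨hev, hcard, hnbr⟩ := hG
  refine extPerfect_of_card_le (Nat.two_pow_pos m) hev ?_ ?_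
  · rw [hnbr]
    exact FOd_subset_nbr_At (by omega)
  · have h := ncard_At_mul_le (m := m) (t := m - 1) (by omega)
    rw [show m - (m - 1) = 1 by omega, show 2 ^ 1 + (m - 1) = m + 1 by omega, ← hcard] at h
    calc 2 * (G.ncard * 2 ^ m) = G.ncard * 2 ^ (m + 1) := by ring
      _ ≤ 2 ^ 2 ^ m := h
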